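/- Let H be a complex Hilbert space of dimension at least 2. There is no positive trace-class operator ρ on H with Tr(ρ) = 1 such that ⟨ψ, ρψ⟩ ∈ {0, 1} for every unit vector ψ ∈ H. Equivalently, no quantum state is dispersion-free on all events: for any density operator ρ there exists a rank-one orthogonal projection P_ψ with 0 < Tr(ρ P_ψ) < 1. -/

import Mathlib

theorem HilbertBasis.nontrivial_of_one_lt_rank {𝕜 E ι : Type*} [RCLike 𝕜]
    [NormedAddCommGroup E] [InnerProductSpace 𝕜 E] (b : HilbertBasis ι 𝕜 E)
    (h : 1 < Module.rank 𝕜 E) : Nontrivial ι := by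
  by_contra hι
  rw [not_nontrivial_iff_subsingleton] at hι
  have hfin : (Set.range b).Finite := Set.finite_range b
  have := FiniteDimensional.span_of_finite 𝕜 hfin
  have htop : Submodule.span 𝕜 (Set.range b) = ⊤ := by
    rw [← b.dense_span]
    exact ((Submodule.closed_of_finiteDimensional _).submodule_topologicalClosure_eq).symm
  have hle := rank_span_le (R := 𝕜) (Set.range b)
  rw [htop, rank_top] at hle
  have hsub : (Set.range b).Subsingleton := Set.subsingleton_range b
  exact (h.trans_le hle).not_ge (Cardinal.mk_le_one_iff_set_subsingleton.2 hsub)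


/-- **No dispersion-free quantum states (von Neumann).**
On a complex Hilbert space of dimension at least 2, for every density operator `ρ`
(a positive operator of trace one, the trace being computed as `∑ i, re ⟪b i, ρ (b i)⟫`
over a Hilbert basis `b`) there exists a unit vector `ψ` (i.e. a rank-one orthoprojector
`P_ψ`) with `0 < Tr(ρ P_ψ) = ⟨ψ, ρ ψ⟩ < 1`.  Hence there is no density operator with
`⟨ψ, ρ ψ⟩ ∈ {0, 1}` for every unit vector `ψ`. -/
theorem no_dispersion_free_state
    {H : Type*} [NormedAddCommGroup H] [InnerProductSpace ℂ H] [CompleteSpace H]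
    (hdim : 2 ≤ Module.rank ℂ H)
    {ι : Type*} (b : HilbertBasis ι ℂ H)
    (ρ : H →L[ℂ] H) (hpos : ρ.IsPositive)
    (htr : HasSum (fun i => (@inner ℂ H _ (b i) (ρ (b i))).re) 1) :
    (∃ ψ : H, ‖ψ‖ = 1 ∧ 0 < (@inner ℂ H _ ψ (ρ ψ)).re ∧ (@inner ℂ H _ ψ (ρ ψ)).re < 1)
      ∧ ¬ (∀ ψ : H, ‖ψ‖ = 1 →
            (@inner ℂ H _ ψ (ρ ψ)).re = 0 ∨ (@inner ℂ H _ ψ (ρ ψ)).re = 1) := by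
  have hnn (x : H) : 0 ≤ (@inner ℂ H _ x (ρ x)).re := hpos.re_inner_nonneg_right x
  have hone : (1 : Cardinal) < 2 := by norm_num
  suffices hψ : ∃ ψ : H, ‖ψ‖ = 1 ∧ 0 < (@inner ℂ H _ ψ (ρ ψ)).re ∧
      (@inner ℂ H _ ψ (ρ ψ)).re < 1 by
    refine ⟨hψ, fun h => ?_⟩
    obtain ⟨ψ, hn, h0, h1⟩ := hψ
    rcases h ψ hn with h | h <;> linarith
  obtain ⟨i, hi⟩ : ∃ i, 0 < (@inner ℂ H _ (b i) (ρ (b i))).re := by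
    by_contra! hall
    have hz (i : ι) : (@inner ℂ H _ (b i) (ρ (b i))).re = 0 := (hall i).antisymm (hnn _)
    simp only [hz] at htr
    exact zero_ne_one (hasSum_zero.unique htr)
  rcases lt_or_ge (@inner ℂ H _ (b i) (ρ (b i))).re 1 with hi1 | hi1
  · exact ⟨b i, b.orthonormal.1 i, hi, hi1⟩
  have := b.nontrivial_of_one_lt_rank (hone.trans_le hdim)
  obtain ⟨j, hji⟩ := exists_ne i
  have hj : (@inner ℂ H _ (b j) (ρ (b j))).re ≤ 0 := by
    classical
    have hle := sum_le_hasSum {j, i} (fun k _ => hnn (b k)) htr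
    rw [Finset.sum_pair hji] at hle
    linarith
  have hrank : 1 < Module.rank ℝ H := by
    rw [rank_real_of_complex]
    exact (hone.trans_le hdim).trans_le (le_mul_of_one_le_left' hone.le)
  have hcont : Continuous fun x : H => (@inner ℂ H _ x (ρ x)).re :=
    Complex.continuous_re.comp (continuous_id.inner ρ.continuous)
  obtain ⟨ψ, hn, hval⟩ := (isPreconnected_sphere hrank (0 : H) 1).intermediate_value
    (mem_sphere_zero_iff_norm.2 (b.orthonormal.1 j))
    (mem_sphere_zero_iff_norm.2 (b.orthonormal.1 i)) hcont.continuousOn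
    (show (1 / 2 : ℝ) ∈ Set.Icc _ _ from ⟨by linarith, by linarith⟩)
  refine ⟨ψ, mem_sphere_zero_iff_norm.1 hn, ?_, ?_⟩ <;> simp only at hval <;> linarith
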